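/- Let a, b, z be complex numbers such that none of 2a, 2b, a + b, a + 1/2, b + 1/2 is a nonpositive integer or zero (so that all Pochhammer denominators are nonzero). Then (Bailey's product formula, the q → 1 limit of Theorem 3): (∑_{k=0}^{∞} (a)_k / ((2a)_k k!) z^k) · (∑_{k=0}^{∞} (b)_k / ((2b)_k k!) (−z)^k) = ∑_{m=0}^{∞} [((a+b)/2)_m ((a+b+1)/2)_m] / [(a + 1/2)_m (b + 1/2)_m (a + b)_m m!] (z²/4)^m, where all three series converge absolutely for every complex z. -/

import Mathlib

/-- The Pochhammer symbol `(x)_k = x (x+1) ⋯ (x+k−1)`. -/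
noncomputable def poch (x : ℂ) (k : ℕ) : ℂ := ∏ j ∈ Finset.range k, (x + j)

section Aux

open Finset PowerSeries

lemma poch_zero (x : ℂ) : poch x 0 = 1 := by simp [poch]
lemma poch_succ (x : ℂ) (k : ℕ) : poch x (k+1) = poch x k * (x + k) := by
  simp [poch, Finset.prod_range_succ]
lemma poch_add (x : ℂ) (k l : ℕ) : poch x (k+l) = poch x k * poch (x + k) l := by
  simp [poch, Finset.prod_range_add, add_assoc]
lemma poch_ne (x : ℂ) (hx : ∀ m : ℕ, x ≠ -(m:ℂ)) (k : ℕ) : poch x k ≠ 0 := by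
  rw [poch, Finset.prod_ne_zero_iff]
  intro j _ h0
  exact hx j (eq_neg_of_add_eq_zero_left h0)

lemma desc_eq (x : ℂ) (k : ℕ) :
    (descPochhammer ℤ k).smeval (x + k - 1) = poch x k := by
  have h1 : ∀ (y : ℂ) (k : ℕ), (descPochhammer ℤ k).smeval y = ∏ j ∈ range k, (y - j) := by
    intro y k
    induction k with
    | zero => simp
    | succ k ih =>
      rw [descPochhammer_succ_right, Polynomial.smeval_mul, ih, Finset.prod_range_succ]
      simp [Polynomial.smeval_sub, Polynomial.smeval_natCast]
  rw [h1, poch, ← Finset.prod_range_reflect]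
  refine Finset.prod_congr rfl fun j hj => ?_
  have : j + 1 ≤ k := by simpa using hj
  rw [Nat.sub_sub, Nat.cast_sub (by omega)]
  push_cast
  ring

lemma vander (c d : ℂ) (n : ℕ) :
    ∑ p ∈ antidiagonal n, (n.choose p.1 : ℂ) * (poch (c + p.2) p.1 * poch (d + p.1) p.2)
      = poch (c + d + n - 1) n := by
  have := Ring.descPochhammer_smeval_add n (Commute.all (c + n - 1) (d + n - 1))
  rw [← desc_eq, show c + d + n - 1 + n - 1 = (c + n - 1) + (d + n - 1) by ring, this]
  refine Finset.sum_congr rfl fun p hp => ?_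
  have hp' : p.1 + p.2 = n := by simpa using hp
  rw [← desc_eq, ← desc_eq, ← hp']
  push_cast
  rw [show c + p.2 + p.1 - 1 = c + (p.1 + p.2) - 1 by ring,
    show d + p.1 + p.2 - 1 = d + (p.1 + p.2) - 1 by ring]

lemma poch_dup (s : ℂ) (n : ℕ) :
    poch s (2 * n) = 4 ^ n * (poch (s / 2) n * poch ((s + 1) / 2) n) := by
  induction n with
  | zero => simp [poch_zero]
  | succ n ih =>
    rw [show 2 * (n+1) = 2 * n + 1 + 1 by ring, poch_succ, poch_succ, ih, poch_succ, poch_succ]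
    push_cast
    ring

/-- coefficients of 0F1(c; x/16) -/
noncomputable def gco (c : ℂ) (m : ℕ) : ℂ := 1 / (poch c m * m.factorial * 16 ^ m)

noncomputable def GG (c : ℂ) : PowerSeries ℂ := PowerSeries.expand 2 two_ne_zero (mk (gco c))

lemma gco_mul (a b : ℂ) (ha : ∀ m : ℕ, a + 1/2 ≠ -(m:ℂ)) (hb : ∀ m : ℕ, b + 1/2 ≠ -(m:ℂ))
    (hab : ∀ m : ℕ, a + b ≠ -(m:ℂ)) (n : ℕ) :
    ∑ p ∈ antidiagonal n, gco (a + 1/2) p.1 * gco (b + 1/2) p.2 =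
      poch ((a + b) / 2) n * poch ((a + b + 1) / 2) n /
            (poch (a + 1 / 2) n * poch (b + 1 / 2) n * poch (a + b) n *
              (n.factorial : ℂ)) * (1 / 4) ^ n := by
  have hv := vander (b + 1/2) (a + 1/2) n
  have hd := poch_dup (a + b) n
  rw [two_mul, poch_add] at hd
  rw [show b + 1/2 + (a + 1/2) + n - 1 = a + b + n by ring] at hv
  rw [← hv] at hd
  have e : ∑ p ∈ antidiagonal n, gco (a + 1/2) p.1 * gco (b + 1/2) p.2 =
    (∑ p ∈ antidiagonal n, (n.choose p.1 : ℂ) * (poch (b + 1/2 + p.2) p.1 * poch (a + 1/2 + p.1) p.2))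
      / (poch (a + 1/2) n * poch (b + 1/2) n * n.factorial * 16 ^ n) := by
    rw [Finset.sum_div]
    refine Finset.sum_congr rfl fun p hp => ?_
    have hp' : p.1 + p.2 = n := by simpa using hp
    obtain ⟨k, l⟩ := p
    simp only at hp' ⊢
    subst hp'
    have h1 := poch_add (a + 1/2) k l
    have h2 := poch_add (b + 1/2) l k
    have h3 : (((k+l).choose k : ℕ) : ℂ) * k.factorial * l.factorial = (k+l).factorial := by
      rw [Nat.choose_symm_add]
      exact_mod_cast Nat.add_choose_mul_factorial_mul_factorial k l
    have n1 := poch_ne _ ha (k + l)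
    have n2 := poch_ne _ hb (l + k)
    have n3 : ((k+l).factorial : ℂ) ≠ 0 := by exact_mod_cast Nat.factorial_ne_zero _
    rw [add_comm l k] at h2 n2
    rw [h1] at n1
    rw [h2] at n2
    rw [← h3] at n3
    rw [h1, h2, ← h3, gco, gco]
    generalize a + 1/2 = c at *
    generalize b + 1/2 = d at *
    simp only [mul_ne_zero_iff] at n1 n2 n3
    obtain ⟨q1, q2⟩ := n1
    obtain ⟨q3, q4⟩ := n2
    obtain ⟨⟨q5, q6⟩, q7⟩ := n3
    rw [pow_add]
    field_simp
  rw [e]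
  have n1 := poch_ne _ ha n
  have n2 := poch_ne _ hb n
  have n3 := poch_ne _ hab n
  have n4 : (n.factorial : ℂ) ≠ 0 := by exact_mod_cast Nat.factorial_ne_zero _
  have n5 : (16:ℂ)^n = 4^n*4^n := by rw [← mul_pow]; norm_num
  rw [n5, one_div_pow]
  set S := ∑ p ∈ antidiagonal n, (n.choose p.1 : ℂ) * (poch (b + 1/2 + p.2) p.1 * poch (a + 1/2 + p.1) p.2)
  generalize S = S at *
  generalize poch (a + 1/2) n = x1 at *
  generalize poch (b + 1/2) n = x2 at *
  generalize poch (a + b) n = x3 at *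
  generalize poch ((a + b)/2) n = x4 at *
  generalize poch ((a + b + 1)/2) n = x5 at *
  field_simp
  linear_combination hd

lemma coeff_odd (c : ℂ) (m : ℕ) : coeff (2 * m + 1) (GG c) = 0 :=
  coeff_expand_of_not_dvd _ _ _ (by omega)

lemma coeff_even (c : ℂ) (m : ℕ) : coeff (2 * m) (GG c) = gco c m := by
  rw [GG, coeff_expand_mul, coeff_mk]

lemma gco_succ (c : ℂ) (hc : ∀ m : ℕ, c ≠ -(m:ℂ)) (m : ℕ) :
    16 * (c + m) * (m + 1) * gco c (m + 1) = gco c m := by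
  have n1 := poch_ne _ hc (m+1)
  have n2 := poch_ne _ hc m
  rw [poch_succ] at n1
  have n3 : c + m ≠ 0 := right_ne_zero_of_mul n1
  have n4 : (m.factorial : ℂ) ≠ 0 := by exact_mod_cast Nat.factorial_ne_zero _
  have n5 : (m + 1 : ℂ) ≠ 0 := by exact_mod_cast Nat.succ_ne_zero m
  rw [gco, gco, poch_succ, Nat.factorial_succ]
  push_cast
  field_simp
  ring

lemma GG_ode (a : ℂ) (ha : ∀ m : ℕ, a + 1/2 ≠ -(m:ℂ)) :
    X * (d⁄dX ℂ (d⁄dX ℂ (GG (a + 1/2)))) + C (2 * a) * (d⁄dX ℂ (GG (a+1/2)))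
      - C (1/4) * (X * GG (a+1/2)) = 0 := by
  ext n
  rcases n with _ | n
  · simp only [map_sub, map_add, coeff_zero_X_mul, coeff_C_mul, coeff_derivative]
    have := coeff_odd (a + 1/2) 0
    simp only [mul_zero, zero_add] at this
    rw [this]
    simp
  · simp only [map_sub, map_add, coeff_succ_X_mul, coeff_C_mul, coeff_derivative, map_zero]
    rcases Nat.even_or_odd' n with ⟨m, rfl | rfl⟩
    · have := gco_succ _ ha m
      rw [coeff_even, show 2 * m + 1 + 1 = 2 * (m + 1) by ring, coeff_even, ← this]
      push_cast
      ring
    · rw [coeff_odd, show 2 * m + 1 + 1 + 1 = 2 * (m + 1) + 1 by ring, coeff_odd]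
      simp

noncomputable def EE (t : ℂ) : PowerSeries ℂ := rescale t (exp ℂ)

lemma EE_deriv (t : ℂ) : d⁄dX ℂ (EE t) = C t * EE t := by
  ext n
  have n5 : (n + 1 : ℂ) ≠ 0 := by exact_mod_cast Nat.succ_ne_zero n
  have n4 : (n.factorial : ℂ) ≠ 0 := by exact_mod_cast Nat.factorial_ne_zero _
  simp only [EE, coeff_derivative, coeff_rescale, coeff_exp, coeff_C_mul, Nat.factorial_succ]
  simp
  field_simp
  ring

noncomputable def FF (a : ℂ) : PowerSeries ℂ :=
  mk fun k => poch a k / (poch (2 * a) k * (k.factorial : ℂ))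

lemma kummer (a : ℂ) (ha : ∀ m : ℕ, a + 1/2 ≠ -(m:ℂ)) (h2 : ∀ m : ℕ, 2 * a ≠ -(m:ℂ)) :
    EE (1/2) * GG (a + 1/2) = FF a := by
  have ode := GG_ode a ha
  set G := GG (a + 1/2) with hG
  set E := EE (1/2) with hE
  have hE' : d⁄dX ℂ E = C (1/2) * E := EE_deriv _
  have c2 : (C (1/2 : ℂ) : PowerSeries ℂ) + C (1/2) = 1 := by
    rw [← map_add]; norm_num
  have c4 : (C (1/4 : ℂ) : PowerSeries ℂ) = C (1/2) * C (1/2) := by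
    rw [← map_mul]; norm_num
  have ca : (C (2 * a) : PowerSeries ℂ) = 2 * C a := by
    rw [two_mul, two_mul, map_add]
  have key : X * (d⁄dX ℂ (d⁄dX ℂ (E * G))) + (C (2 * a) - X) * (d⁄dX ℂ (E * G))
      - C a * (E * G) = 0 := by
    simp only [Derivation.leibniz, map_add, smul_eq_mul, hE', derivative_C]
    rw [c4] at ode
    rw [ca] at ode ⊢
    generalize d⁄dX ℂ (d⁄dX ℂ G) = G2 at *
    generalize d⁄dX ℂ G = G1 at *
    generalize (C (1/2 : ℂ) : PowerSeries ℂ) = u at *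
    generalize (C a : PowerSeries ℂ) = v at *
    clear_value E G
    linear_combination E * ode + (X * E * G1 + v * E * G + X * E * G * u) * c2
  have hrec : ∀ n : ℕ, (n + 1) * (n + 2 * a) * coeff (n + 1) (E * G) = (n + a) * coeff n (E * G) := by
    intro n
    have := congrArg (coeff n) key
    rcases n with _ | n
    · simp only [sub_mul, map_sub, map_add, coeff_zero_X_mul, coeff_C_mul, coeff_derivative, map_zero] at this
      push_cast at this ⊢
      linear_combination this
    · simp only [sub_mul, map_sub, map_add, coeff_succ_X_mul, coeff_C_mul, coeff_derivative, map_zero] at this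
      push_cast at this ⊢
      linear_combination this
  ext n
  rw [FF, coeff_mk]
  induction n with
  | zero =>
    have e0 : constantCoeff (EE (1/2)) = 1 := by
      rw [← coeff_zero_eq_constantCoeff_apply, EE, coeff_rescale]
      simp
    rw [coeff_zero_eq_constantCoeff_apply, map_mul, hE, e0]
    simp [hG, GG, gco, poch_zero]
  | succ n ih =>
    have hr := hrec n
    rw [ih] at hr
    have n5 : (n + 1 : ℂ) ≠ 0 := by exact_mod_cast Nat.succ_ne_zero n
    have n4 : (n.factorial : ℂ) ≠ 0 := by exact_mod_cast Nat.factorial_ne_zero _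
    have n1 := poch_ne _ h2 (n+1)
    have n2 := poch_ne _ h2 n
    rw [poch_succ] at n1
    have n3 := right_ne_zero_of_mul n1
    have n3' : n + 2 * a ≠ 0 := by rwa [add_comm]
    apply mul_left_cancel₀ (mul_ne_zero n5 n3')
    rw [hr, poch_succ, poch_succ, Nat.factorial_succ]
    push_cast
    rw [add_comm (n : ℂ) (2 * a)]
    clear hr n3' n1
    generalize poch (2 * a) n = q at *
    generalize 2 * a + (n : ℂ) = t at *
    field_simp
    ring

lemma GG_neg (c : ℂ) : evalNegHom (GG c) = GG c := by
  ext n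
  rw [evalNegHom, coeff_rescale]
  rcases Nat.even_or_odd' n with ⟨m, rfl | rfl⟩
  · simp [pow_mul]
  · simp [coeff_odd]

lemma EE_neg : EE (1/2) * evalNegHom (EE (1/2)) = 1 := by
  have : evalNegHom (EE (1/2)) = EE (-(1/2)) := by
    ext n
    rw [evalNegHom, coeff_rescale, EE, EE, coeff_rescale, coeff_rescale, neg_pow (1/2 : ℂ), mul_assoc]
  rw [this, EE, EE, exp_mul_exp_eq_exp_add]
  simp

lemma prod_eq (a b : ℂ) (ha : ∀ m : ℕ, a + 1/2 ≠ -(m:ℂ)) (h2 : ∀ m : ℕ, 2 * a ≠ -(m:ℂ))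
    (hb : ∀ m : ℕ, b + 1/2 ≠ -(m:ℂ)) (h2b : ∀ m : ℕ, 2 * b ≠ -(m:ℂ)) :
    FF a * evalNegHom (FF b) =
      PowerSeries.expand 2 two_ne_zero (mk (gco (a + 1/2)) * mk (gco (b + 1/2))) := by
  rw [← kummer a ha h2, ← kummer b hb h2b, map_mul, map_mul, GG_neg]
  change _ = GG (a + 1/2) * GG (b+1/2)
  linear_combination (GG (a + 1/2) * GG (b+1/2)) * EE_neg

open Filter Topology in
lemma summ_aux (f r : ℕ → ℂ) (hr : Tendsto r atTop (𝓝 0)) (h : ∀ n, f (n+1) = r n * f n) :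
    Summable fun n => ‖f n‖ := by
  apply Summable.norm
  apply summable_of_ratio_norm_eventually_le (r := 1/2) (by norm_num)
  have := hr.norm
  rw [norm_zero] at this
  filter_upwards [this.eventually (gt_mem_nhds (show (0:ℝ) < 1/2 by norm_num))] with n hn
  rw [h, norm_mul]
  gcongr

open Filter Topology in
lemma lim_aux (x y : ℂ) : Tendsto (fun n : ℕ => (x + n) / (y + n)) atTop (𝓝 1) := by
  have h1 : ∀ t : ℂ, Tendsto (fun n : ℕ => t / n + 1) atTop (𝓝 1) := fun t => by
    simpa using (tendsto_const_div_atTop_nhds_zero_nat t).add_const 1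
  have := (h1 x).div (h1 y) one_ne_zero
  rw [div_one] at this
  refine this.congr' ?_
  filter_upwards [eventually_gt_atTop 0] with n hn
  have : (n : ℂ) ≠ 0 := by exact_mod_cast hn.ne'
  simp only [Pi.div_apply]
  rw [div_add_one this, div_add_one this, div_div_div_cancel_right₀ this]

open Filter Topology in
lemma lim_inv (y : ℂ) : Tendsto (fun n : ℕ => 1 / (y + n)) atTop (𝓝 0) := by
  have h0 : Tendsto (fun n : ℕ => 1 / (n : ℂ)) atTop (𝓝 0) := tendsto_const_div_atTop_nhds_zero_nat 1
  have := (lim_aux 0 y).mul h0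
  rw [mul_zero] at this
  refine this.congr' ?_
  filter_upwards [eventually_gt_atTop 0] with n hn
  have : (n : ℂ) ≠ 0 := by exact_mod_cast hn.ne'
  rw [zero_add]
  field_simp

lemma summ1 (a w : ℂ) : Summable (fun k : ℕ =>
          ‖poch a k / (poch (2 * a) k * (k.factorial : ℂ)) * w ^ k‖) := by
  apply summ_aux _ (fun n => (a + n) / (2 * a + n) * (1 / (1 + n)) * w)
  · simpa using ((lim_aux a (2 * a)).mul (lim_inv 1)).mul_const w
  · intro n
    rw [poch_succ, poch_succ, Nat.factorial_succ, pow_succ, add_comm (1 : ℂ)]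
    push_cast
    simp only [div_eq_mul_inv, mul_inv]
    ring

lemma summ2 (p q c d e w : ℂ) : Summable (fun m : ℕ =>
          ‖poch p m * poch q m / (poch c m * poch d m * poch e m * (m.factorial : ℂ)) * w ^ m‖) := by
  apply summ_aux _ (fun n => (p + n) / (c + n) * ((q + n) / (d + n)) * (1 / (e + n)) * (1 / (1 + n)) * w)
  · simpa using ((((lim_aux p c).mul (lim_aux q d)).mul (lim_inv e)).mul (lim_inv 1)).mul_const w
  · intro n
    simp only [poch_succ]
    rw [Nat.factorial_succ, pow_succ, add_comm (1 : ℂ)]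
    push_cast
    simp only [div_eq_mul_inv, mul_inv]
    ring

end Aux

/-- Bailey's product formula, the `q → 1` limit of Theorem 3:
`₁F₁[a; 2a; z] · ₁F₁[b; 2b; −z] = ₂F₃[(a+b)/2, (a+b+1)/2; a+1/2, b+1/2, a+b; z²/4]`,
where all three series converge absolutely for every complex `z`. -/
theorem bailey_product_1F1 (a b z : ℂ)
    (h : ∀ m : ℕ, 2 * a ≠ -(m : ℂ) ∧ 2 * b ≠ -(m : ℂ) ∧ a + b ≠ -(m : ℂ) ∧
      a + 1 / 2 ≠ -(m : ℂ) ∧ b + 1 / 2 ≠ -(m : ℂ)) :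
    ((∀ w : ℂ,
        Summable (fun k : ℕ =>
          ‖poch a k / (poch (2 * a) k * (k.factorial : ℂ)) * w ^ k‖) ∧
        Summable (fun k : ℕ =>
          ‖poch b k / (poch (2 * b) k * (k.factorial : ℂ)) * (-w) ^ k‖) ∧
        Summable (fun m : ℕ =>
          ‖poch ((a + b) / 2) m * poch ((a + b + 1) / 2) m /
            (poch (a + 1 / 2) m * poch (b + 1 / 2) m * poch (a + b) m *
              (m.factorial : ℂ)) * (w ^ 2 / 4) ^ m‖)) ∧
      (∑' k : ℕ, poch a k / (poch (2 * a) k * (k.factorial : ℂ)) * z ^ k) *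
          (∑' k : ℕ, poch b k / (poch (2 * b) k * (k.factorial : ℂ)) * (-z) ^ k) =
        ∑' m : ℕ,
          poch ((a + b) / 2) m * poch ((a + b + 1) / 2) m /
            (poch (a + 1 / 2) m * poch (b + 1 / 2) m * poch (a + b) m *
              (m.factorial : ℂ)) * (z ^ 2 / 4) ^ m) := by
  have h1 := fun m => (h m).1
  have h2 := fun m => (h m).2.1
  have h3 := fun m => (h m).2.2.1
  have h4 := fun m => (h m).2.2.2.1
  have h5 := fun m => (h m).2.2.2.2
  refine ⟨fun w => ⟨summ1 a w, summ1 b (-w), summ2 _ _ _ _ _ _⟩, ?_⟩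
  rw [tsum_mul_tsum_eq_tsum_sum_antidiagonal_of_summable_norm (summ1 a z) (summ1 b (-z))]
  have hP := prod_eq a b h4 h1 h5 h2
  have e : ∀ n : ℕ, ∑ kl ∈ Finset.HasAntidiagonal.antidiagonal n,
      poch a kl.1 / (poch (2 * a) kl.1 * (kl.1.factorial : ℂ)) * z ^ kl.1 *
      (poch b kl.2 / (poch (2 * b) kl.2 * (kl.2.factorial : ℂ)) * (-z) ^ kl.2) =
      PowerSeries.coeff n (PowerSeries.expand 2 two_ne_zero
        (PowerSeries.mk (gco (a + 1/2)) * PowerSeries.mk (gco (b + 1/2)))) * z ^ n := by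
    intro n
    rw [← hP, PowerSeries.coeff_mul, Finset.sum_mul]
    refine Finset.sum_congr rfl fun p hp => ?_
    have hp' : p.1 + p.2 = n := by simpa using hp
    rw [← hp', FF, FF, PowerSeries.evalNegHom, PowerSeries.coeff_rescale, PowerSeries.coeff_mk,
      PowerSeries.coeff_mk, neg_pow z, pow_add]
    ring
  simp only [e]
  have hinj : Function.Injective (fun m : ℕ => 2 * m) := fun x y hxy => by
    simpa using hxy
  rw [← hinj.tsum_eq]
  · refine tsum_congr fun m => ?_
    rw [PowerSeries.coeff_expand_mul, PowerSeries.coeff_mul]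
    simp only [PowerSeries.coeff_mk]
    rw [gco_mul a b h4 h5 h3, mul_assoc, pow_mul, ← mul_pow]
    congr 2
    ring
  · intro n hn
    by_contra hc
    apply hn
    beta_reduce
    rw [PowerSeries.coeff_expand_of_not_dvd, zero_mul]
    rintro ⟨k, rfl⟩
    exact hc ⟨k, rfl⟩
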